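/- arXiv:1109.0024 — 4 statements merged into one kernel-verified Lean document; each statement's English description precedes it below -/
import Mathlib

section
/- Let A and B be groups and G a subgroup of A × B. Then G is finite cyclic if and only if Ḡ₁ and Ḡ₂ are both finite cyclic and the orders |G₁| and |G₂| are coprime. Moreover, in this case |G| = lcm(|Ḡ₁|, |Ḡ₂|). -/
theorem Nat.eq_lcm_iff_coprime_of_eq_mul {N m n k l : ℕ} (hN : N ≠ 0) (hm : m * l = N)
    (hn : n * k = N) : N = Nat.lcm m n ↔ Nat.Coprime k l := by
  have hm0 : 0 < m := Nat.pos_of_ne_zero (by rintro rfl; simp at hm; omega)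
  have hn0 : 0 < n := Nat.pos_of_ne_zero (by rintro rfl; simp at hn; omega)
  constructor
  · intro h
    obtain ⟨b, hb⟩ := Nat.gcd_dvd_left k l
    obtain ⟨a, ha⟩ := Nat.gcd_dvd_right k l
    rw [Nat.Coprime]
    generalize Nat.gcd k l = d at *
    subst hb ha
    have hd : 0 < d := Nat.pos_of_ne_zero (by rintro rfl; simp at hm; omega)
    have hab : m * a = n * b := Nat.eq_of_mul_eq_mul_left hd (by linarith)
    have hdvd : N ∣ m * a := h ▸ Nat.lcm_dvd (Dvd.intro _ rfl) (hab ▸ Dvd.intro _ rfl)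
    have hma : 0 < m * a := Nat.pos_of_ne_zero (by
      intro h0
      apply hN
      rw [← hm, Nat.mul_left_comm, h0, Nat.mul_zero])
    have hle := Nat.le_of_dvd hma hdvd
    nlinarith
  · intro h
    obtain ⟨q, hq⟩ : Nat.lcm m n ∣ N := Nat.lcm_dvd ⟨l, hm.symm⟩ ⟨k, hn.symm⟩
    obtain ⟨c, hc⟩ := Nat.dvd_lcm_left m n
    obtain ⟨d, hd⟩ := Nat.dvd_lcm_right m n
    have hl : q ∣ l := ⟨c, Nat.eq_of_mul_eq_mul_left hm0 (by rw [hm, hq, hc]; ring)⟩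
    have hk : q ∣ k := ⟨d, Nat.eq_of_mul_eq_mul_left hn0 (by rw [hn, hq, hd]; ring)⟩
    rw [Nat.eq_one_of_dvd_coprimes h hk hl] at hq
    simpa using hq

namespace Subgroup

variable {A B : Type*} [Group A] [Group B]

theorem card_map_mul_card_ker_subgroupMap {H K : Type*} [Group H] [Group K] (f : H →* K)
    (G : Subgroup H) : Nat.card (G.map f) * Nat.card (f.subgroupMap G).ker = Nat.card G := by
  rw [← (f.subgroupMap G).ker.card_mul_index, index_ker,
    MonoidHom.range_eq_top.mpr (f.subgroupMap_surjective G), card_top, mul_comm]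

theorem card_map_fst_mul_card_comap_inr (G : Subgroup (A × B)) :
    Nat.card (G.map (MonoidHom.fst A B)) * Nat.card (G.comap (MonoidHom.inr A B)) =
      Nat.card G := by
  rw [← card_map_mul_card_ker_subgroupMap (MonoidHom.fst A B) G]
  congr 1
  refine Nat.card_congr
    { toFun := fun b => ⟨⟨(1, b.1), b.2⟩, Subtype.ext rfl⟩
      invFun := fun x => ⟨x.1.1.2, ?_⟩
      left_inv := fun b => rfl
      right_inv := ?_ }
  · obtain ⟨⟨⟨a, b⟩, hx⟩, h⟩ := x
    obtain rfl : a = 1 := congrArg Subtype.val h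
    exact hx
  · rintro ⟨⟨⟨a, b⟩, hx⟩, h⟩
    obtain rfl : a = 1 := congrArg Subtype.val h
    rfl

theorem card_map_snd_mul_card_comap_inl (G : Subgroup (A × B)) :
    Nat.card (G.map (MonoidHom.snd A B)) * Nat.card (G.comap (MonoidHom.inl A B)) =
      Nat.card G := by
  rw [← card_map_mul_card_ker_subgroupMap (MonoidHom.snd A B) G]
  congr 1
  refine Nat.card_congr
    { toFun := fun a => ⟨⟨(a.1, 1), a.2⟩, Subtype.ext rfl⟩
      invFun := fun x => ⟨x.1.1.1, ?_⟩
      left_inv := fun a => rfl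
      right_inv := ?_ }
  · obtain ⟨⟨⟨a, b⟩, hx⟩, h⟩ := x
    obtain rfl : b = 1 := congrArg Subtype.val h
    exact hx
  · rintro ⟨⟨⟨a, b⟩, hx⟩, h⟩
    obtain rfl : b = 1 := congrArg Subtype.val h
    rfl

/-- The embedding of a subgroup of `A × B` into the product of its two projections. -/
def toProdMap (G : Subgroup (A × B)) :
    G →* G.map (MonoidHom.fst A B) × G.map (MonoidHom.snd A B) :=
  ((MonoidHom.fst A B).subgroupMap G).prod ((MonoidHom.snd A B).subgroupMap G)

theorem toProdMap_injective (G : Subgroup (A × B)) : Function.Injective G.toProdMap := by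
  intro x y h
  exact Subtype.ext (Prod.ext (congrArg (fun z => (z.1 : A)) h) (congrArg (fun z => (z.2 : B)) h))

theorem exponent_eq_lcm_exponent_map (G : Subgroup (A × B)) :
    Monoid.exponent G = Nat.lcm (Monoid.exponent (G.map (MonoidHom.fst A B)))
      (Monoid.exponent (G.map (MonoidHom.snd A B))) := by
  apply Nat.dvd_antisymm
  · have h := Monoid.exponent_dvd_of_monoidHom G.toProdMap G.toProdMap_injective
    rwa [Monoid.exponent_prod] at h
  · exact Nat.lcm_dvd (MonoidHom.exponent_dvd ((MonoidHom.fst A B).subgroupMap_surjective G))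
      (MonoidHom.exponent_dvd ((MonoidHom.snd A B).subgroupMap_surjective G))

theorem exponent_eq_lcm_card_map (G : Subgroup (A × B))
    [IsCyclic (G.map (MonoidHom.fst A B))] [IsCyclic (G.map (MonoidHom.snd A B))] :
    Monoid.exponent G = Nat.lcm (Nat.card (G.map (MonoidHom.fst A B)))
      (Nat.card (G.map (MonoidHom.snd A B))) := by
  rw [exponent_eq_lcm_exponent_map, IsCyclic.exponent_eq_card, IsCyclic.exponent_eq_card]

theorem isCyclic_iff_card_eq_lcm_card_map (G : Subgroup (A × B)) [Finite G]
    [h₁ : IsCyclic (G.map (MonoidHom.fst A B))] [h₂ : IsCyclic (G.map (MonoidHom.snd A B))] :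
    IsCyclic G ↔ Nat.card G = Nat.lcm (Nat.card (G.map (MonoidHom.fst A B)))
      (Nat.card (G.map (MonoidHom.snd A B))) := by
  let _ := h₁.commGroup
  let _ := h₂.commGroup
  let _ : CommGroup G :=
    { mul_comm := fun x y => G.toProdMap_injective (by
        rw [map_mul, map_mul]
        exact Prod.ext (mul_comm _ _) (mul_comm _ _)) }
  rw [← exponent_eq_lcm_card_map, eq_comm]
  exact IsCyclic.iff_exponent_eq_card

end Subgroup

/-- A subgroup `G` of `A × B` is finite cyclic if and only if `Ḡ₁` and `Ḡ₂` are both finite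
cyclic and the orders of `G₁` and `G₂` are coprime; in that case `|G| = lcm(|Ḡ₁|, |Ḡ₂|)`. -/
theorem finite_cyclic_subgroup_prod_iff {A B : Type*} [Group A] [Group B]
    (G : Subgroup (A × B)) :
    ((Finite G ∧ IsCyclic G) ↔
      (Finite (G.map (MonoidHom.fst A B)) ∧ IsCyclic (G.map (MonoidHom.fst A B)) ∧
       Finite (G.map (MonoidHom.snd A B)) ∧ IsCyclic (G.map (MonoidHom.snd A B)) ∧
       Nat.Coprime (Nat.card (G.comap (MonoidHom.inl A B)))
         (Nat.card (G.comap (MonoidHom.inr A B))))) ∧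
    ((Finite G ∧ IsCyclic G) →
      Nat.card G = Nat.lcm (Nat.card (G.map (MonoidHom.fst A B)))
        (Nat.card (G.map (MonoidHom.snd A B)))) := by
  have key (_ : Finite G) : Nat.card G = Nat.lcm (Nat.card (G.map (MonoidHom.fst A B)))
      (Nat.card (G.map (MonoidHom.snd A B))) ↔
      Nat.Coprime (Nat.card (G.comap (MonoidHom.inl A B)))
        (Nat.card (G.comap (MonoidHom.inr A B))) :=
    Nat.eq_lcm_iff_coprime_of_eq_mul Nat.card_pos.ne' G.card_map_fst_mul_card_comap_inr
      G.card_map_snd_mul_card_comap_inl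
  have forward (_ : Finite G) (_ : IsCyclic G) :
      IsCyclic (G.map (MonoidHom.fst A B)) ∧ IsCyclic (G.map (MonoidHom.snd A B)) :=
    ⟨isCyclic_of_surjective _ ((MonoidHom.fst A B).subgroupMap_surjective G),
      isCyclic_of_surjective _ ((MonoidHom.snd A B).subgroupMap_surjective G)⟩
  have card_eq (h : Finite G ∧ IsCyclic G) :
      Nat.card G = Nat.lcm (Nat.card (G.map (MonoidHom.fst A B)))
        (Nat.card (G.map (MonoidHom.snd A B))) := by
    obtain ⟨hfin, hcyc⟩ := h
    obtain ⟨_, _⟩ := forward hfin hcyc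
    exact G.isCyclic_iff_card_eq_lcm_card_map.mp hcyc
  refine ⟨⟨fun h => ?_, ?_⟩, card_eq⟩
  · obtain ⟨hfin, hcyc⟩ := h
    obtain ⟨h₁, h₂⟩ := forward hfin hcyc
    exact ⟨Finite.of_surjective _ ((MonoidHom.fst A B).subgroupMap_surjective G), h₁,
      Finite.of_surjective _ ((MonoidHom.snd A B).subgroupMap_surjective G), h₂,
      (key hfin).mp (card_eq ⟨hfin, hcyc⟩)⟩
  · rintro ⟨_, _, _, _, hcop⟩
    have hfin : Finite G := Finite.of_injective _ G.toProdMap_injective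
    exact ⟨hfin, G.isCyclic_iff_card_eq_lcm_card_map.mpr ((key hfin).mpr hcop)⟩
end

section
/- Let A and B be groups and G a subgroup of A × B. Then G is infinite cyclic (isomorphic to ℤ) if and only if one of the following holds: (i) Ḡ₁ is infinite cyclic, Ḡ₂ is finite cyclic, and G₂ is trivial; (ii) Ḡ₂ is infinite cyclic, Ḡ₁ is finite cyclic, and G₁ is trivial; (iii) both Ḡ₁ and Ḡ₂ are infinite cyclic and G₁ and G₂ are both trivial. -/
theorem nonempty_mulEquiv_multiplicative_int_iff {H : Type*} [Group H] :
    Nonempty (H ≃* Multiplicative ℤ) ↔ IsCyclic H ∧ Infinite H := by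
  constructor
  · rintro ⟨e⟩
    exact ⟨isCyclic_of_surjective e.symm e.symm.surjective, Infinite.of_injective _ e.symm.injective⟩
  · rintro ⟨_, _⟩
    exact ⟨mulEquivOfCyclicCardEq (by simp)⟩

theorem MonoidHom.injective_of_surjective_of_isCyclic_of_infinite {G H : Type*} [Group G] [Group H]
    [IsCyclic G] [Infinite H] (f : G →* H) (hf : Function.Surjective f) :
    Function.Injective f := by
  obtain ⟨g, hg⟩ := IsCyclic.exists_generator (α := G)
  have hfg : orderOf (f g) = 0 := by
    refine Infinite.orderOf_eq_zero_of_forall_mem_zpowers fun y => ?_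
    obtain ⟨x, rfl⟩ := hf y
    obtain ⟨n, rfl⟩ := hg x
    exact ⟨n, by simp⟩
  refine (injective_iff_map_eq_one f).2 fun x hx => ?_
  obtain ⟨n, rfl⟩ := hg x
  have hn : (orderOf (f g) : ℤ) ∣ n := orderOf_dvd_iff_zpow_eq_one.2 (by simpa using hx)
  have hn0 : n = 0 := by simpa [hfg] using hn
  simp [hn0]

namespace Subgroup

theorem subgroupMap_fst_injective_iff {A B : Type*} [Group A] [Group B] (G : Subgroup (A × B)) :
    Function.Injective ((MonoidHom.fst A B).subgroupMap G) ↔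
      G.comap (MonoidHom.inr A B) = ⊥ := by
  rw [injective_iff_map_eq_one, eq_bot_iff_forall]
  constructor
  · intro h b hb
    exact congrArg (fun z => z.1.2) (h ⟨(1, b), hb⟩ (Subtype.ext rfl))
  · rintro h ⟨⟨a, b⟩, hab⟩ hx
    obtain rfl : a = 1 := congrArg Subtype.val hx
    obtain rfl : b = 1 := h b hab
    rfl

theorem subgroupMap_snd_injective_iff {A B : Type*} [Group A] [Group B] (G : Subgroup (A × B)) :
    Function.Injective ((MonoidHom.snd A B).subgroupMap G) ↔
      G.comap (MonoidHom.inl A B) = ⊥ := by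
  rw [injective_iff_map_eq_one, eq_bot_iff_forall]
  constructor
  · intro h a ha
    exact congrArg (fun z => z.1.1) (h ⟨(a, 1), ha⟩ (Subtype.ext rfl))
  · rintro h ⟨⟨a, b⟩, hab⟩ hx
    obtain rfl : b = 1 := congrArg Subtype.val hx
    obtain rfl : a = 1 := h a hab
    rfl

theorem finite_of_finite_map_fst_of_finite_map_snd {A B : Type*} [Group A] [Group B]
    (G : Subgroup (A × B)) [Finite (G.map (MonoidHom.fst A B))]
    [Finite (G.map (MonoidHom.snd A B))] : Finite G :=
  Finite.of_injective
    (((MonoidHom.fst A B).subgroupMap G).prod ((MonoidHom.snd A B).subgroupMap G)) fun _ _ h =>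
      Subtype.ext (Prod.ext (congrArg (fun z => (z.1 : A)) h) (congrArg (fun z => (z.2 : B)) h))

end Subgroup


/-- A subgroup `G` of `A × B` is infinite cyclic (isomorphic to `ℤ`) if and only if either
(i) `Ḡ₁` is infinite cyclic, `Ḡ₂` is finite cyclic and `G₂` is trivial, or
(ii) `Ḡ₂` is infinite cyclic, `Ḡ₁` is finite cyclic and `G₁` is trivial, or
(iii) `Ḡ₁` and `Ḡ₂` are infinite cyclic and `G₁`, `G₂` are both trivial. -/
theorem infinite_cyclic_subgroup_prod_iff {A B : Type*} [Group A] [Group B]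
    (G : Subgroup (A × B)) :
    Nonempty (G ≃* Multiplicative ℤ) ↔
      (Nonempty ((G.map (MonoidHom.fst A B)) ≃* Multiplicative ℤ) ∧
        Finite (G.map (MonoidHom.snd A B)) ∧ IsCyclic (G.map (MonoidHom.snd A B)) ∧
        G.comap (MonoidHom.inr A B) = ⊥) ∨
      (Nonempty ((G.map (MonoidHom.snd A B)) ≃* Multiplicative ℤ) ∧
        Finite (G.map (MonoidHom.fst A B)) ∧ IsCyclic (G.map (MonoidHom.fst A B)) ∧
        G.comap (MonoidHom.inl A B) = ⊥) ∨
      (Nonempty ((G.map (MonoidHom.fst A B)) ≃* Multiplicative ℤ) ∧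
        Nonempty ((G.map (MonoidHom.snd A B)) ≃* Multiplicative ℤ) ∧
        G.comap (MonoidHom.inl A B) = ⊥ ∧ G.comap (MonoidHom.inr A B) = ⊥) := by
  have hsurj₁ := (MonoidHom.fst A B).subgroupMap_surjective G
  have hsurj₂ := (MonoidHom.snd A B).subgroupMap_surjective G
  rw [← G.subgroupMap_fst_injective_iff, ← G.subgroupMap_snd_injective_iff]
  constructor
  · intro hG
    obtain ⟨_, _⟩ := nonempty_mulEquiv_multiplicative_int_iff.1 hG
    have hcyc₁ := isCyclic_of_surjective _ hsurj₁
    have hcyc₂ := isCyclic_of_surjective _ hsurj₂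
    simp only [nonempty_mulEquiv_multiplicative_int_iff]
    rcases finite_or_infinite (G.map (MonoidHom.fst A B)) with h₁ | h₁ <;>
      rcases finite_or_infinite (G.map (MonoidHom.snd A B)) with h₂ | h₂
    · exact (not_finite_iff_infinite.2 ‹Infinite G›
        G.finite_of_finite_map_fst_of_finite_map_snd).elim
    · exact .inr (.inl ⟨⟨hcyc₂, h₂⟩, h₁, hcyc₁,
        MonoidHom.injective_of_surjective_of_isCyclic_of_infinite _ hsurj₂⟩)
    · exact .inl ⟨⟨hcyc₁, h₁⟩, h₂, hcyc₂,
        MonoidHom.injective_of_surjective_of_isCyclic_of_infinite _ hsurj₁⟩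
    · exact .inr (.inr ⟨⟨hcyc₁, h₁⟩, ⟨hcyc₂, h₂⟩,
        MonoidHom.injective_of_surjective_of_isCyclic_of_infinite _ hsurj₂,
        MonoidHom.injective_of_surjective_of_isCyclic_of_infinite _ hsurj₁⟩)
  · rintro (⟨⟨e⟩, -, -, h⟩ | ⟨⟨e⟩, -, -, h⟩ | ⟨⟨e⟩, -, -, h⟩)
    · exact ⟨(MulEquiv.ofBijective _ ⟨h, hsurj₁⟩).trans e⟩
    · exact ⟨(MulEquiv.ofBijective _ ⟨h, hsurj₂⟩).trans e⟩
    · exact ⟨(MulEquiv.ofBijective _ ⟨h, hsurj₁⟩).trans e⟩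
end

section
/- Let A, B, C be groups and G a subgroup of A × B × C. Then G is finite cyclic if and only if Ḡ₁, Ḡ₂, Ḡ₃ are all finite cyclic and each of the pairs of integers (|G(1|2)|, |G(2|1)|), (|G(1|3)|, |G(3|1)|), (|G(2|3)|, |G(3|2)|) is coprime. Moreover, in this case |G| = lcm(|Ḡ₁|, |Ḡ₂|, |Ḡ₃|). -/
section TripleDefs

variable (A B C : Type*) [Group A] [Group B] [Group C]

/-- The projection `A × B × C →* A`. -/
def projFst : A × B × C →* A := MonoidHom.fst A (B × C)

/-- The projection `A × B × C →* B`. -/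
def projSnd : A × B × C →* B := (MonoidHom.fst B C).comp (MonoidHom.snd A (B × C))

/-- The projection `A × B × C →* C`. -/
def projThd : A × B × C →* C := (MonoidHom.snd B C).comp (MonoidHom.snd A (B × C))

variable {A B C}

/-- `G(1|2) = {a | (a, e, c) ∈ G for some c}`. -/
def G₁₂ (G : Subgroup (A × B × C)) : Subgroup A := (G ⊓ (projSnd A B C).ker).map (projFst A B C)

/-- `G(1|3) = {a | (a, b, e) ∈ G for some b}`. -/
def G₁₃ (G : Subgroup (A × B × C)) : Subgroup A := (G ⊓ (projThd A B C).ker).map (projFst A B C)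

/-- `G(2|1) = {b | (e, b, c) ∈ G for some c}`. -/
def G₂₁ (G : Subgroup (A × B × C)) : Subgroup B := (G ⊓ (projFst A B C).ker).map (projSnd A B C)

/-- `G(2|3) = {b | (a, b, e) ∈ G for some a}`. -/
def G₂₃ (G : Subgroup (A × B × C)) : Subgroup B := (G ⊓ (projThd A B C).ker).map (projSnd A B C)

/-- `G(3|1) = {c | (e, b, c) ∈ G for some b}`. -/
def G₃₁ (G : Subgroup (A × B × C)) : Subgroup C := (G ⊓ (projFst A B C).ker).map (projThd A B C)

/-- `G(3|2) = {c | (a, e, c) ∈ G for some a}`. -/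
def G₃₂ (G : Subgroup (A × B × C)) : Subgroup C := (G ⊓ (projSnd A B C).ker).map (projThd A B C)

end TripleDefs

section Subdirect

variable {Γ M N : Type*} [Group Γ] [Group M] [Group N]

theorem Subgroup.coprime_card_map_inf_ker (f : Γ →* M) (g : Γ →* N) (G : Subgroup Γ)
    [Finite G] [IsCyclic G] :
    Nat.Coprime (Nat.card ((G ⊓ g.ker).map f)) (Nat.card ((G ⊓ f.ker).map g)) := by
  have hle : ((G ⊓ g.ker).map f).prod ((G ⊓ f.ker).map g) ≤ G.map (f.prod g) := by
    rw [Subgroup.prod_le_iff]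
    constructor
    · rintro _ ⟨_, ⟨x, ⟨hx, hgx⟩, rfl⟩, rfl⟩
      exact ⟨x, hx, Prod.ext rfl hgx⟩
    · rintro _ ⟨_, ⟨x, ⟨hx, hfx⟩, rfl⟩, rfl⟩
      exact ⟨x, hx, Prod.ext hfx rfl⟩
  have hG : IsCyclic (G.map (f.prod g)) :=
    isCyclic_of_surjective _ ((f.prod g).subgroupMap_surjective G)
  have hprod := Subgroup.isCyclic_of_le hle
  rw [(Subgroup.prodEquiv _ _).isCyclic] at hprod
  exact (Group.isCyclic_prod_iff.1 hprod).2.2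

theorem IsPGroup.map_eq_one_of_not_dvd_card {p : ℕ} [Fact p.Prime] (f : Γ →* M) (g : Γ →* N)
    {G : Subgroup Γ} {P : Subgroup G} (hP : IsPGroup p P)
    (hp : ¬ p ∣ Nat.card ((G ⊓ g.ker).map f)) {x : G} (hx : x ∈ P) (hgx : g x = 1) :
    f x = 1 := by
  obtain ⟨k, hk⟩ := hP ⟨x, hx⟩
  have hk' : (x : Γ) ^ p ^ k = 1 := congrArg (fun y : P ↦ ((y : G) : Γ)) hk
  have hpow : f x ^ p ^ k = 1 := by rw [← map_pow, hk', map_one]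
  have hcard : f x ^ Nat.card ((G ⊓ g.ker).map f) = 1 :=
    congrArg Subtype.val (pow_card_eq_one' (x := (⟨f x, x, ⟨x.2, hgx⟩, rfl⟩ :
      (G ⊓ g.ker).map f)))
  have hcop : Nat.Coprime (p ^ k) (Nat.card ((G ⊓ g.ker).map f)) :=
    ((Fact.out : p.Prime).coprime_iff_not_dvd.2 hp).pow_left k
  rw [← orderOf_eq_one_iff]
  exact Nat.eq_one_of_dvd_coprimes hcop (orderOf_dvd_of_pow_eq_one hpow)
    (orderOf_dvd_of_pow_eq_one hcard)

theorem IsPGroup.ker_le_or_ker_le {p : ℕ} [Fact p.Prime] (f : Γ →* M) (g : Γ →* N)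
    {G : Subgroup Γ} {P : Subgroup G} (hP : IsPGroup p P)
    (h : Nat.Coprime (Nat.card ((G ⊓ g.ker).map f)) (Nat.card ((G ⊓ f.ker).map g))) :
    (∀ x ∈ P, g x = 1 → f x = 1) ∨ (∀ x ∈ P, f x = 1 → g x = 1) := by
  by_cases hp : p ∣ Nat.card ((G ⊓ g.ker).map f)
  · have hp' : ¬ p ∣ Nat.card ((G ⊓ f.ker).map g) := fun hp' ↦
      Nat.not_coprime_of_dvd_of_dvd (Fact.out : p.Prime).one_lt hp hp' h
    exact .inr fun x hx ↦ hP.map_eq_one_of_not_dvd_card g f hp' hx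
  · exact .inl fun x hx ↦ hP.map_eq_one_of_not_dvd_card f g hp hx

theorem Subgroup.isCyclic_of_map_isCyclic (f : Γ →* M) {G : Subgroup Γ} [IsCyclic (G.map f)]
    {P : Subgroup G} (h : ∀ x ∈ P, f x = 1 → x = 1) : IsCyclic P := by
  refine isCyclic_of_injective ((f.subgroupMap G).comp P.subtype) ?_
  rw [injective_iff_map_eq_one]
  intro x hx
  exact Subtype.ext (h x x.2 (congrArg Subtype.val hx))

end Subdirect

section Triple

variable {A B C : Type*} [Group A] [Group B] [Group C]

theorem eq_one_of_proj_eq_one {x : A × B × C} (h₁ : projFst A B C x = 1)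
    (h₂ : projSnd A B C x = 1) (h₃ : projThd A B C x = 1) : x = 1 :=
  Prod.ext h₁ (Prod.ext h₂ h₃)

theorem finite_of_finite_map_proj (G : Subgroup (A × B × C))
    [Finite (G.map (projFst A B C))] [Finite (G.map (projSnd A B C))]
    [Finite (G.map (projThd A B C))] : Finite G := by
  refine Finite.of_injective (((projFst A B C).subgroupMap G).prod
    (((projSnd A B C).subgroupMap G).prod ((projThd A B C).subgroupMap G))) ?_
  rw [injective_iff_map_eq_one]
  intro x hx
  simp only [MonoidHom.prod_apply, Prod.mk_eq_one] at hx
  exact Subtype.ext (eq_one_of_proj_eq_one (congrArg Subtype.val hx.1)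
    (congrArg Subtype.val hx.2.1) (congrArg Subtype.val hx.2.2))

theorem isMulCommutative_of_map_proj (G : Subgroup (A × B × C))
    [IsMulCommutative (G.map (projFst A B C))] [IsMulCommutative (G.map (projSnd A B C))]
    [IsMulCommutative (G.map (projThd A B C))] : IsMulCommutative G := by
  refine ⟨⟨fun x y ↦ Subtype.ext (Prod.ext ?_ (Prod.ext ?_ ?_))⟩⟩
  · exact setLike_mul_comm (s := G.map (projFst A B C))
      (Subgroup.mem_map_of_mem _ x.2) (Subgroup.mem_map_of_mem _ y.2)
  · exact setLike_mul_comm (s := G.map (projSnd A B C))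
      (Subgroup.mem_map_of_mem _ x.2) (Subgroup.mem_map_of_mem _ y.2)
  · exact setLike_mul_comm (s := G.map (projThd A B C))
      (Subgroup.mem_map_of_mem _ x.2) (Subgroup.mem_map_of_mem _ y.2)

theorem isZGroup_of_coprime_card_proj (G : Subgroup (A × B × C))
    [IsCyclic (G.map (projFst A B C))] [IsCyclic (G.map (projSnd A B C))]
    [IsCyclic (G.map (projThd A B C))]
    (h₁₂ : Nat.Coprime (Nat.card (G₁₂ G)) (Nat.card (G₂₁ G)))
    (h₁₃ : Nat.Coprime (Nat.card (G₁₃ G)) (Nat.card (G₃₁ G)))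
    (h₂₃ : Nat.Coprime (Nat.card (G₂₃ G)) (Nat.card (G₃₂ G))) : IsZGroup G := by
  refine ⟨fun p hp P ↦ ?_⟩
  have := Fact.mk hp
  have key (x : G) (h₁ : projFst A B C x = 1) (h₂ : projSnd A B C x = 1)
      (h₃ : projThd A B C x = 1) : x = 1 := Subtype.ext (eq_one_of_proj_eq_one h₁ h₂ h₃)
  have c₁₂ := P.isPGroup'.ker_le_or_ker_le (projFst A B C) (projSnd A B C) h₁₂
  have c₁₃ := P.isPGroup'.ker_le_or_ker_le (projFst A B C) (projThd A B C) h₁₃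
  have c₂₃ := P.isPGroup'.ker_le_or_ker_le (projSnd A B C) (projThd A B C) h₂₃
  have hinj : (∀ x ∈ P.toSubgroup, projFst A B C x = 1 → x = 1) ∨
      (∀ x ∈ P.toSubgroup, projSnd A B C x = 1 → x = 1) ∨
      (∀ x ∈ P.toSubgroup, projThd A B C x = 1 → x = 1) := by
    rcases c₁₂ with _ | _ <;> rcases c₁₃ with _ | _ <;> rcases c₂₃ with _ | _ <;>
      first
      | exact .inl fun x _ h ↦ key x h (by solve_by_elim) (by solve_by_elim)
      | exact .inr (.inl fun x _ h ↦ key x (by solve_by_elim) h (by solve_by_elim))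
      | exact .inr (.inr fun x _ h ↦ key x (by solve_by_elim) (by solve_by_elim) h)
  rcases hinj with h | h | h
  · exact Subgroup.isCyclic_of_map_isCyclic _ h
  · exact Subgroup.isCyclic_of_map_isCyclic _ h
  · exact Subgroup.isCyclic_of_map_isCyclic _ h

theorem isCyclic_of_coprime_card_proj (G : Subgroup (A × B × C)) [Finite G]
    [IsCyclic (G.map (projFst A B C))] [IsCyclic (G.map (projSnd A B C))]
    [IsCyclic (G.map (projThd A B C))]
    (h₁₂ : Nat.Coprime (Nat.card (G₁₂ G)) (Nat.card (G₂₁ G)))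
    (h₁₃ : Nat.Coprime (Nat.card (G₁₃ G)) (Nat.card (G₃₁ G)))
    (h₂₃ : Nat.Coprime (Nat.card (G₂₃ G)) (Nat.card (G₃₂ G))) : IsCyclic G := by
  have := isZGroup_of_coprime_card_proj G h₁₂ h₁₃ h₂₃
  have := isMulCommutative_of_map_proj G
  have : Group.IsNilpotent G := by
    let _ : CommGroup G := { mul_comm := mul_comm' }
    exact CommGroup.isNilpotent
  infer_instance

theorem card_eq_lcm_card_map_proj (G : Subgroup (A × B × C)) [IsCyclic G] :
    Nat.card G = Nat.lcm (Nat.card (G.map (projFst A B C)))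
      (Nat.lcm (Nat.card (G.map (projSnd A B C))) (Nat.card (G.map (projThd A B C)))) := by
  obtain ⟨x, rfl⟩ := Subgroup.isCyclic_iff_exists_zpowers_eq_top G |>.1 inferInstance
  simp only [MonoidHom.map_zpowers, Nat.card_zpowers]
  exact (Prod.orderOf x).trans (congrArg _ (Prod.orderOf x.2))

end Triple

/-- A subgroup `G` of `A × B × C` is finite cyclic if and only if `Ḡ₁`, `Ḡ₂`, `Ḡ₃` are all
finite cyclic and each of the pairs `(|G(1|2)|, |G(2|1)|)`, `(|G(1|3)|, |G(3|1)|)`,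
`(|G(2|3)|, |G(3|2)|)` is coprime; in that case `|G| = lcm(|Ḡ₁|, |Ḡ₂|, |Ḡ₃|)`. -/
theorem finite_cyclic_subgroup_prod_three_iff {A B C : Type*} [Group A] [Group B] [Group C]
    (G : Subgroup (A × B × C)) :
    ((Finite G ∧ IsCyclic G) ↔
      (Finite (G.map (projFst A B C)) ∧ IsCyclic (G.map (projFst A B C)) ∧
       Finite (G.map (projSnd A B C)) ∧ IsCyclic (G.map (projSnd A B C)) ∧
       Finite (G.map (projThd A B C)) ∧ IsCyclic (G.map (projThd A B C)) ∧
       Nat.Coprime (Nat.card (G₁₂ G)) (Nat.card (G₂₁ G)) ∧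
       Nat.Coprime (Nat.card (G₁₃ G)) (Nat.card (G₃₁ G)) ∧
       Nat.Coprime (Nat.card (G₂₃ G)) (Nat.card (G₃₂ G)))) ∧
    ((Finite G ∧ IsCyclic G) →
      Nat.card G = Nat.lcm (Nat.card (G.map (projFst A B C)))
        (Nat.lcm (Nat.card (G.map (projSnd A B C))) (Nat.card (G.map (projThd A B C))))) := by
  refine ⟨⟨?_, ?_⟩, ?_⟩
  · rintro ⟨_, _⟩
    exact ⟨Finite.of_surjective _ ((projFst A B C).subgroupMap_surjective G),
      isCyclic_of_surjective _ ((projFst A B C).subgroupMap_surjective G),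
      Finite.of_surjective _ ((projSnd A B C).subgroupMap_surjective G),
      isCyclic_of_surjective _ ((projSnd A B C).subgroupMap_surjective G),
      Finite.of_surjective _ ((projThd A B C).subgroupMap_surjective G),
      isCyclic_of_surjective _ ((projThd A B C).subgroupMap_surjective G),
      G.coprime_card_map_inf_ker _ _, G.coprime_card_map_inf_ker _ _,
      G.coprime_card_map_inf_ker _ _⟩
  · rintro ⟨_, _, _, _, _, _, h₁₂, h₁₃, h₂₃⟩
    have := finite_of_finite_map_proj G
    exact ⟨this, isCyclic_of_coprime_card_proj G h₁₂ h₁₃ h₂₃⟩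
  · rintro ⟨_, _⟩
    exact card_eq_lcm_card_map_proj G
end

section
/- Let A, B, C be groups and G a subgroup of A × B × C. Then G is infinite cyclic (isomorphic to ℤ) if and only if, up to a permutation of the three indices, one of the following holds: (i) Ḡ₁ ≅ ℤ, Ḡ₂ and Ḡ₃ are finite cyclic, G(2|1) and G(3|1) are trivial, and |G(2|3)| and |G(3|2)| are coprime; (ii) Ḡ₁ ≅ Ḡ₂ ≅ ℤ, Ḡ₃ is finite cyclic, and G(2|1), G(3|1), G(1|2), G(3|2) are all trivial; (iii) Ḡ₁ ≅ Ḡ₂ ≅ Ḡ₃ ≅ ℤ and G(i|j) is trivial for all distinct i, j ∈ {1,2,3}. -/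
section CyclicSubgroups

variable {H K L : Type*} [Group H] [Group K] [Group L]

theorem nonempty_zpowers_mulEquiv_int {g : H} (hg : ¬IsOfFinOrder g) :
    Nonempty (Subgroup.zpowers g ≃* Multiplicative ℤ) :=
  have : Infinite (Subgroup.zpowers g) := (infinite_zpowers.mpr hg).to_subtype
  ⟨intCyclicMulEquiv.symm⟩

theorem exists_eq_zpowers_of_mulEquiv_int {G : Subgroup H} (e : G ≃* Multiplicative ℤ) :
    ∃ g : H, ¬IsOfFinOrder g ∧ G = Subgroup.zpowers g := by
  have : IsCyclic G := e.isCyclic.mpr inferInstance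
  obtain ⟨g, rfl⟩ := G.isCyclic_iff_exists_zpowers_eq_top.mp this
  have : Infinite (Subgroup.zpowers g) := e.toEquiv.infinite_iff.mpr inferInstance
  exact ⟨g, infinite_zpowers.mp (Set.infinite_coe_iff.mp this), rfl⟩

theorem zpowers_inf_ker (f : H →* K) (g : H) :
    Subgroup.zpowers g ⊓ f.ker = Subgroup.zpowers (g ^ orderOf (f g)) := by
  ext x
  simp only [Subgroup.mem_inf, Subgroup.mem_zpowers_iff, MonoidHom.mem_ker]
  constructor
  · rintro ⟨⟨k, rfl⟩, hk⟩
    rw [map_zpow, ← orderOf_dvd_iff_zpow_eq_one] at hk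
    obtain ⟨m, rfl⟩ := hk
    exact ⟨m, by rw [zpow_mul, zpow_natCast]⟩
  · rintro ⟨k, rfl⟩
    exact ⟨⟨orderOf (f g) * k, by rw [zpow_mul, zpow_natCast]⟩, by simp [pow_orderOf_eq_one]⟩

theorem map_zpowers_inf_ker (f : H →* K) (h : H →* L) (g : H) :
    (Subgroup.zpowers g ⊓ f.ker).map h = Subgroup.zpowers (h g ^ orderOf (f g)) := by
  rw [zpowers_inf_ker, MonoidHom.map_zpowers, map_pow]

theorem map_zpowers_inf_ker_eq_bot (f : H →* K) (h : H →* L) {g : H}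
    (hg : ¬IsOfFinOrder (f g)) : (Subgroup.zpowers g ⊓ f.ker).map h = ⊥ := by
  rw [map_zpowers_inf_ker, orderOf_eq_zero hg, pow_zero, Subgroup.zpowers_one_eq_bot]

theorem coprime_card_map_zpowers_inf_ker (f : H →* K) (h : H →* L) {g : H}
    (hf : IsOfFinOrder (f g)) (hh : IsOfFinOrder (h g)) :
    Nat.Coprime (Nat.card ((Subgroup.zpowers g ⊓ h.ker).map f))
      (Nat.card ((Subgroup.zpowers g ⊓ f.ker).map h)) := by
  rw [map_zpowers_inf_ker, map_zpowers_inf_ker, Nat.card_zpowers, Nat.card_zpowers,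
    orderOf_pow' _ hh.orderOf_pos.ne', orderOf_pow' _ hf.orderOf_pos.ne',
    Nat.gcd_comm (orderOf (h g))]
  exact Nat.coprime_div_gcd_div_gcd (Nat.gcd_pos_of_pos_left _ hf.orderOf_pos)

theorem nonempty_mulEquiv_map {G : Subgroup H} {f : H →* K} (hf : G ⊓ f.ker = ⊥) :
    Nonempty (G ≃* G.map f) := by
  refine ⟨MulEquiv.ofBijective (f.subgroupMap G) ⟨?_, f.subgroupMap_surjective G⟩⟩
  rw [injective_iff_map_eq_one]
  intro x hx
  have hx' : (x : H) ∈ G ⊓ f.ker := ⟨x.2, congrArg Subtype.val hx⟩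
  rw [hf, Subgroup.mem_bot] at hx'
  exact Subtype.ext hx'

theorem finite_zpowers_and_isCyclic {g : H} (hg : IsOfFinOrder g) :
    Finite (Subgroup.zpowers g) ∧ IsCyclic (Subgroup.zpowers g) :=
  ⟨finite_zpowers.mpr hg, inferInstance⟩

end CyclicSubgroups

section TripleProduct

variable {A B C : Type*} [Group A] [Group B] [Group C] {G : Subgroup (A × B × C)}

theorem inf_ker_projFst_eq_bot (h₂ : G₂₁ G = ⊥) (h₃ : G₃₁ G = ⊥) :
    G ⊓ (projFst A B C).ker = ⊥ := by
  rw [G₂₁, Subgroup.map_eq_bot_iff] at h₂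
  rw [G₃₁, Subgroup.map_eq_bot_iff] at h₃
  exact (Subgroup.eq_bot_iff_forall _).mpr fun x hx =>
    Prod.ext hx.2 (Prod.ext (h₂ hx) (h₃ hx))

theorem inf_ker_projSnd_eq_bot (h₁ : G₁₂ G = ⊥) (h₃ : G₃₂ G = ⊥) :
    G ⊓ (projSnd A B C).ker = ⊥ := by
  rw [G₁₂, Subgroup.map_eq_bot_iff] at h₁
  rw [G₃₂, Subgroup.map_eq_bot_iff] at h₃
  exact (Subgroup.eq_bot_iff_forall _).mpr fun x hx =>
    Prod.ext (h₁ hx) (Prod.ext hx.2 (h₃ hx))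

theorem inf_ker_projThd_eq_bot (h₁ : G₁₃ G = ⊥) (h₂ : G₂₃ G = ⊥) :
    G ⊓ (projThd A B C).ker = ⊥ := by
  rw [G₁₃, Subgroup.map_eq_bot_iff] at h₁
  rw [G₂₃, Subgroup.map_eq_bot_iff] at h₂
  exact (Subgroup.eq_bot_iff_forall _).mpr fun x hx =>
    Prod.ext (h₁ hx) (Prod.ext (h₂ hx) hx.2)

theorem isOfFinOrder_of_proj {g : A × B × C} (h₁ : IsOfFinOrder (projFst A B C g))
    (h₂ : IsOfFinOrder (projSnd A B C g)) (h₃ : IsOfFinOrder (projThd A B C g)) :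
    IsOfFinOrder g :=
  h₁.prod_mk (h₂.prod_mk h₃)

end TripleProduct

/-- A subgroup `G` of `A × B × C` is infinite cyclic (isomorphic to `ℤ`) if and only if, up to a
permutation of the three indices, one of the following holds:
(i) one projection `Ḡₖ` is infinite cyclic, the other two are finite cyclic, `G(i|k)` is trivial
for `i ≠ k`, and the cardinalities of the two cross subgroups of the remaining pair are coprime;
(ii) two projections are infinite cyclic, the third `Ḡₖ` is finite cyclic, and `G(i|j)` is
trivial for every `j ≠ k`, `i ≠ j`;
(iii) all three projections are infinite cyclic and all `G(i|j)` (`i ≠ j`) are trivial. -/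
theorem infinite_cyclic_subgroup_prod_three_iff {A B C : Type*} [Group A] [Group B] [Group C]
    (G : Subgroup (A × B × C)) :
    Nonempty (G ≃* Multiplicative ℤ) ↔
      -- case (i), distinguished infinite index 1
      ((Nonempty ((G.map (projFst A B C)) ≃* Multiplicative ℤ) ∧
        Finite (G.map (projSnd A B C)) ∧ IsCyclic (G.map (projSnd A B C)) ∧
        Finite (G.map (projThd A B C)) ∧ IsCyclic (G.map (projThd A B C)) ∧
        G₂₁ G = ⊥ ∧ G₃₁ G = ⊥ ∧
        Nat.Coprime (Nat.card (G₂₃ G)) (Nat.card (G₃₂ G))) ∨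
      -- case (i), distinguished infinite index 2
      (Nonempty ((G.map (projSnd A B C)) ≃* Multiplicative ℤ) ∧
        Finite (G.map (projFst A B C)) ∧ IsCyclic (G.map (projFst A B C)) ∧
        Finite (G.map (projThd A B C)) ∧ IsCyclic (G.map (projThd A B C)) ∧
        G₁₂ G = ⊥ ∧ G₃₂ G = ⊥ ∧
        Nat.Coprime (Nat.card (G₁₃ G)) (Nat.card (G₃₁ G))) ∨
      -- case (i), distinguished infinite index 3
      (Nonempty ((G.map (projThd A B C)) ≃* Multiplicative ℤ) ∧
        Finite (G.map (projFst A B C)) ∧ IsCyclic (G.map (projFst A B C)) ∧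
        Finite (G.map (projSnd A B C)) ∧ IsCyclic (G.map (projSnd A B C)) ∧
        G₁₃ G = ⊥ ∧ G₂₃ G = ⊥ ∧
        Nat.Coprime (Nat.card (G₁₂ G)) (Nat.card (G₂₁ G))) ∨
      -- case (ii), distinguished finite index 3
      (Nonempty ((G.map (projFst A B C)) ≃* Multiplicative ℤ) ∧
        Nonempty ((G.map (projSnd A B C)) ≃* Multiplicative ℤ) ∧
        Finite (G.map (projThd A B C)) ∧ IsCyclic (G.map (projThd A B C)) ∧
        G₂₁ G = ⊥ ∧ G₃₁ G = ⊥ ∧ G₁₂ G = ⊥ ∧ G₃₂ G = ⊥) ∨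
      -- case (ii), distinguished finite index 2
      (Nonempty ((G.map (projFst A B C)) ≃* Multiplicative ℤ) ∧
        Nonempty ((G.map (projThd A B C)) ≃* Multiplicative ℤ) ∧
        Finite (G.map (projSnd A B C)) ∧ IsCyclic (G.map (projSnd A B C)) ∧
        G₂₁ G = ⊥ ∧ G₃₁ G = ⊥ ∧ G₁₃ G = ⊥ ∧ G₂₃ G = ⊥) ∨
      -- case (ii), distinguished finite index 1
      (Nonempty ((G.map (projSnd A B C)) ≃* Multiplicative ℤ) ∧
        Nonempty ((G.map (projThd A B C)) ≃* Multiplicative ℤ) ∧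
        Finite (G.map (projFst A B C)) ∧ IsCyclic (G.map (projFst A B C)) ∧
        G₁₂ G = ⊥ ∧ G₃₂ G = ⊥ ∧ G₁₃ G = ⊥ ∧ G₂₃ G = ⊥) ∨
      -- case (iii)
      (Nonempty ((G.map (projFst A B C)) ≃* Multiplicative ℤ) ∧
        Nonempty ((G.map (projSnd A B C)) ≃* Multiplicative ℤ) ∧
        Nonempty ((G.map (projThd A B C)) ≃* Multiplicative ℤ) ∧
        G₁₂ G = ⊥ ∧ G₁₃ G = ⊥ ∧ G₂₁ G = ⊥ ∧ G₂₃ G = ⊥ ∧ G₃₁ G = ⊥ ∧ G₃₂ G = ⊥)) := by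
  constructor
  · rintro ⟨e⟩
    obtain ⟨g, hg, rfl⟩ := exists_eq_zpowers_of_mulEquiv_int e
    simp only [G₁₂, G₁₃, G₂₁, G₂₃, G₃₁, G₃₂]
    have e₁ := MonoidHom.map_zpowers (projFst A B C) g
    have e₂ := MonoidHom.map_zpowers (projSnd A B C) g
    have e₃ := MonoidHom.map_zpowers (projThd A B C) g
    have fin₁ := finite_zpowers_and_isCyclic (g := projFst A B C g)
    have fin₂ := finite_zpowers_and_isCyclic (g := projSnd A B C g)
    have fin₃ := finite_zpowers_and_isCyclic (g := projThd A B C g)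
    have inf₁ := nonempty_zpowers_mulEquiv_int (g := projFst A B C g)
    have inf₂ := nonempty_zpowers_mulEquiv_int (g := projSnd A B C g)
    have inf₃ := nonempty_zpowers_mulEquiv_int (g := projThd A B C g)
    rw [← e₁] at fin₁ inf₁
    rw [← e₂] at fin₂ inf₂
    rw [← e₃] at fin₃ inf₃
    have h₁₂ := map_zpowers_inf_ker_eq_bot (projSnd A B C) (projFst A B C) (g := g)
    have h₁₃ := map_zpowers_inf_ker_eq_bot (projThd A B C) (projFst A B C) (g := g)
    have h₂₁ := map_zpowers_inf_ker_eq_bot (projFst A B C) (projSnd A B C) (g := g)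
    have h₂₃ := map_zpowers_inf_ker_eq_bot (projThd A B C) (projSnd A B C) (g := g)
    have h₃₁ := map_zpowers_inf_ker_eq_bot (projFst A B C) (projThd A B C) (g := g)
    have h₃₂ := map_zpowers_inf_ker_eq_bot (projSnd A B C) (projThd A B C) (g := g)
    have c₁₂ := coprime_card_map_zpowers_inf_ker (projFst A B C) (projSnd A B C) (g := g)
    have c₁₃ := coprime_card_map_zpowers_inf_ker (projFst A B C) (projThd A B C) (g := g)
    have c₂₃ := coprime_card_map_zpowers_inf_ker (projSnd A B C) (projThd A B C) (g := g)
    by_cases a : IsOfFinOrder (projFst A B C g) <;> by_cases b : IsOfFinOrder (projSnd A B C g) <;>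
      by_cases c : IsOfFinOrder (projThd A B C g)
    · exact absurd (isOfFinOrder_of_proj a b c) hg
    · exact .inr (.inr (.inl ⟨inf₃ c, (fin₁ a).1, (fin₁ a).2, (fin₂ b).1, (fin₂ b).2,
        h₁₃ c, h₂₃ c, c₁₂ a b⟩))
    · exact .inr (.inl ⟨inf₂ b, (fin₁ a).1, (fin₁ a).2, (fin₃ c).1, (fin₃ c).2,
        h₁₂ b, h₃₂ b, c₁₃ a c⟩)
    · exact .inr (.inr (.inr (.inr (.inr (.inl ⟨inf₂ b, inf₃ c, (fin₁ a).1, (fin₁ a).2,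
        h₁₂ b, h₃₂ b, h₁₃ c, h₂₃ c⟩)))))
    · exact .inl ⟨inf₁ a, (fin₂ b).1, (fin₂ b).2, (fin₃ c).1, (fin₃ c).2,
        h₂₁ a, h₃₁ a, c₂₃ b c⟩
    · exact .inr (.inr (.inr (.inr (.inl ⟨inf₁ a, inf₃ c, (fin₂ b).1, (fin₂ b).2,
        h₂₁ a, h₃₁ a, h₁₃ c, h₂₃ c⟩))))
    · exact .inr (.inr (.inr (.inl ⟨inf₁ a, inf₂ b, (fin₃ c).1, (fin₃ c).2,
        h₂₁ a, h₃₁ a, h₁₂ b, h₃₂ b⟩)))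
    · exact .inr (.inr (.inr (.inr (.inr (.inr ⟨inf₁ a, inf₂ b, inf₃ c,
        h₁₂ b, h₁₃ c, h₂₁ a, h₂₃ c, h₃₁ a, h₃₂ b⟩)))))
  · have key₁ (h : Nonempty (G.map (projFst A B C) ≃* Multiplicative ℤ)) (h₂ : G₂₁ G = ⊥)
        (h₃ : G₃₁ G = ⊥) : Nonempty (G ≃* Multiplicative ℤ) :=
      (nonempty_mulEquiv_map (inf_ker_projFst_eq_bot h₂ h₃)).map2 MulEquiv.trans h
    have key₂ (h : Nonempty (G.map (projSnd A B C) ≃* Multiplicative ℤ)) (h₁ : G₁₂ G = ⊥)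
        (h₃ : G₃₂ G = ⊥) : Nonempty (G ≃* Multiplicative ℤ) :=
      (nonempty_mulEquiv_map (inf_ker_projSnd_eq_bot h₁ h₃)).map2 MulEquiv.trans h
    have key₃ (h : Nonempty (G.map (projThd A B C) ≃* Multiplicative ℤ)) (h₁ : G₁₃ G = ⊥)
        (h₂ : G₂₃ G = ⊥) : Nonempty (G ≃* Multiplicative ℤ) :=
      (nonempty_mulEquiv_map (inf_ker_projThd_eq_bot h₁ h₂)).map2 MulEquiv.trans h
    rintro (⟨h, -, -, -, -, h₂, h₃, -⟩ | ⟨h, -, -, -, -, h₁, h₃, -⟩ |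
      ⟨h, -, -, -, -, h₁, h₂, -⟩ | ⟨h, -, -, -, h₂, h₃, -⟩ | ⟨h, -, -, -, h₂, h₃, -⟩ |
      ⟨h, -, -, -, h₁, h₃, -⟩ | ⟨h, -, -, -, -, h₂, -, h₃, -⟩)
    exacts [key₁ h h₂ h₃, key₂ h h₁ h₃, key₃ h h₁ h₂, key₁ h h₂ h₃, key₁ h h₂ h₃,
      key₂ h h₁ h₃, key₁ h h₂ h₃]
end
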